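/- arXiv:2411.11095 — 3 statements merged into one kernel-verified Lean document; each statement's English description precedes it below -/
import Mathlib

section
/- Let n ≥ 2 and d ≥ 1. With respect to the standard basis {E_{ij} : 1 ≤ i ≤ j ≤ n} of the Lie algebra ut_n(C) of upper triangular n×n complex matrices (with variable x_{ij} attached to E_{ij}, and write x_i := x_{ii}), the coefficient algebra B_{ut_n(C)}(S^d(C^n)) equals the algebra C[x_1,…,x_n]^{S_n} of symmetric polynomials in the diagonal variables x_1,…,x_n, where the symmetric group S_n acts by permuting x_1,…,x_n. -/
open MvPolynomial Matrix

noncomputable section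

/-- The matrix of the derivation action of an `n × n` matrix `A` on the `d`-th symmetric
power of the standard representation, with respect to the monomial basis indexed by
`Sym (Fin n) d`. -/
def symMat {R : Type*} [CommRing R] (n d : ℕ) (A : Matrix (Fin n) (Fin n) R) :
    Matrix (Sym (Fin n) d) (Sym (Fin n) d) R :=
  fun a b => ∑ i : Fin n, ∑ j : Fin n,
    if (b : Multiset (Fin n)) = ((a : Multiset (Fin n)).erase i) + {j}
    then (Multiset.count i (a : Multiset (Fin n)) : R) * A i j else 0

/-- The characteristic polynomial `det(x₀·I + M)`, viewed as a polynomial in `x₀` with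
coefficients in the base (multivariate polynomial) ring. -/
def charP {m R : Type*} [Fintype m] [DecidableEq m] [CommRing R] (M : Matrix m m R) :
    Polynomial R :=
  Matrix.det ((Polynomial.X : Polynomial R) • (1 : Matrix m m (Polynomial R)) + M.map Polynomial.C)

/-- The coefficient algebra: the subalgebra generated by all coefficients of the
characteristic polynomial. -/
def coeffAlg {m : Type*} [Fintype m] [DecidableEq m] (K : Type*) [CommRing K] {ι : Type*}
    (M : Matrix m m (MvPolynomial ι K)) : Subalgebra K (MvPolynomial ι K) :=
  Algebra.adjoin K (Set.range (charP M).coeff)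

/-- Index type for the standard basis `E_{ij}`, `i ≤ j`, of `ut_n(ℂ)`. -/
def UTIdx (n : ℕ) : Type := {p : Fin n × Fin n // p.1 ≤ p.2}

/-- The generic upper triangular matrix `Σ_{i ≤ j} x_{ij}·E_{ij}`. -/
def utGen (n : ℕ) : Matrix (Fin n) (Fin n) (MvPolynomial (UTIdx n) ℂ) :=
  fun i j => if h : i ≤ j then MvPolynomial.X (⟨(i, j), h⟩ : UTIdx n) else 0

/-- A matrix that is strictly upper triangular off the diagonal with respect to some grading of the
index set has determinant the product of its diagonal entries. -/
theorem det_eq_prod_diag_of_grading {m R : Type*} [Fintype m] [DecidableEq m] [CommRing R]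
    (M : Matrix m m R) (s : m → ℕ) (h : ∀ a b, a ≠ b → s b ≤ s a → M a b = 0) :
    M.det = ∏ a, M a a := by
  have hM : BlockTriangular M s := fun a b hab => h a b (by rintro rfl; simp at hab) hab.le
  rw [hM.det, ← Finset.prod_fiberwise_of_maps_to
    (fun a _ => Finset.mem_image_of_mem s (Finset.mem_univ a))]
  refine Finset.prod_congr rfl fun k _ => ?_
  have hdiag : M.toSquareBlock s k = diagonal fun i : {a // s a = k} => M i i := by
    ext i j
    by_cases hij : i = j
    · subst hij
      simp [toSquareBlock_def]
    · rw [diagonal_apply_ne _ hij]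
      exact h _ _ (fun e => hij (Subtype.ext e)) (j.2.trans i.2.symm).le
  rw [hdiag, det_diagonal]
  exact (Finset.prod_subtype _ (by simp) fun a => M a a).symm

/-- For upper triangular `A`, an off-diagonal entry of `symMat n d A` vanishes unless the index sum
of its column exceeds that of its row. -/
theorem symMat_apply_eq_zero {R : Type*} [CommRing R] {n d : ℕ} {A : Matrix (Fin n) (Fin n) R}
    (hA : ∀ i j, j < i → A i j = 0) {a b : Sym (Fin n) d} (hab : a ≠ b)
    (hs : ((b : Multiset (Fin n)).map Fin.val).sum ≤ ((a : Multiset (Fin n)).map Fin.val).sum) :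
    symMat n d A a b = 0 := by
  refine Finset.sum_eq_zero fun i _ => Finset.sum_eq_zero fun j _ => ?_
  split_ifs with h
  · by_cases hi : i ∈ (a : Multiset (Fin n))
    · rcases lt_trichotomy j i with hji | rfl | hij
      · rw [hA i j hji, mul_zero]
      · refine absurd (Sym.coe_injective ?_) hab
        rw [h, add_comm, Multiset.singleton_add, Multiset.cons_erase hi]
      · rw [h] at hs
        nth_rewrite 2 [← Multiset.cons_erase hi] at hs
        rw [Multiset.map_add, Multiset.sum_add, Multiset.map_cons, Multiset.sum_cons,
          Multiset.map_singleton, Multiset.sum_singleton] at hs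
        omega
    · simp [Multiset.count_eq_zero_of_notMem hi]
  · rfl

theorem symMat_apply_self {R : Type*} [CommRing R] {n d : ℕ} (A : Matrix (Fin n) (Fin n) R)
    (a : Sym (Fin n) d) :
    symMat n d A a a = ((a : Multiset (Fin n)).map fun i => A i i).sum := by
  rw [Finset.sum_multiset_map_count, Finset.sum_subset (Finset.subset_univ _)]
  · refine Finset.sum_congr rfl fun i _ => ?_
    by_cases hi : i ∈ (a : Multiset (Fin n))
    · rw [Finset.sum_eq_single i]
      · rw [if_pos, nsmul_eq_mul]
        rw [add_comm, Multiset.singleton_add, Multiset.cons_erase hi]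
      · intro j _ hji
        rw [if_neg]
        intro h
        nth_rewrite 1 [← Multiset.cons_erase hi] at h
        rw [add_comm, Multiset.singleton_add, Multiset.cons_inj_left] at h
        exact hji h.symm
      · simp
    · simp [Multiset.count_eq_zero_of_notMem hi]
  · intro i _ hi
    simp [Multiset.count_eq_zero_of_notMem (fun h => hi (Multiset.mem_toFinset.2 h))]

theorem charP_symMat {R : Type*} [CommRing R] {n d : ℕ} {A : Matrix (Fin n) (Fin n) R}
    (hA : ∀ i j, j < i → A i j = 0) :
    charP (symMat n d A) = ∏ a : Sym (Fin n) d,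
      (Polynomial.X + Polynomial.C ((a : Multiset (Fin n)).map fun i => A i i).sum) := by
  rw [_root_.charP, det_eq_prod_diag_of_grading _
    fun a : Sym (Fin n) d => ((a : Multiset (Fin n)).map Fin.val).sum]
  · simp [symMat_apply_self]
  · intro a b hab hs
    simp [one_apply_ne hab, symMat_apply_eq_zero hA hab hs]

section PowerSums

variable {σ : Type*} [Fintype σ] [DecidableEq σ]

theorem sum_sym_filter_le_count {M : Type*} [AddCommMonoid M] {d m : ℕ} (hm : m ≤ d) (i : σ)
    (f : Multiset σ → M) :
    ∑ a ∈ (Finset.univ : Finset (Sym σ d)).filter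
        (fun a : Sym σ d => m ≤ Multiset.count i (a : Multiset σ)), f a =
      ∑ a : Sym σ (d - m), f (a + Multiset.replicate m i) := by
  symm
  refine Finset.sum_bij (fun a _ => Sym.mk ((a : Multiset σ) + Multiset.replicate m i) (by simp [hm]))
    ?_ ?_ ?_ ?_
  · intro a _
    exact Finset.mem_filter.2 ⟨Finset.mem_univ _, by simp [Sym.mk]⟩
  · intro a _ b _ h
    exact Sym.coe_injective (add_right_cancel (congrArg Subtype.val h))
  · intro b hb
    have hle : Multiset.replicate m i ≤ (b : Multiset σ) :=
      Multiset.le_count_iff_replicate_le.1 (Finset.mem_filter.1 hb).2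
    refine ⟨⟨(b : Multiset σ) - Multiset.replicate m i, ?_⟩, Finset.mem_univ _, ?_⟩
    · rw [Multiset.card_sub hle]
      simp
    · exact Sym.coe_injective (tsub_add_cancel_of_le hle)
  · intro a _
    rfl

theorem nsmul_sum_sym {M : Type*} [AddCommMonoid M] (d : ℕ) (f : Multiset σ → M) :
    d • ∑ a : Sym σ d, f a =
      ∑ m ∈ Finset.range d, ∑ i : σ, ∑ a : Sym σ (d - (m + 1)),
        f (a + Multiset.replicate (m + 1) i) := by
  have hcount (a : Sym σ d) : d • f a =
      ∑ m ∈ Finset.range d, ∑ i : σ, if m + 1 ≤ Multiset.count i (a : Multiset σ)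
        then f a else 0 := by
    rw [Finset.sum_comm]
    have hi (i : σ) : (∑ m ∈ Finset.range d, if m + 1 ≤ Multiset.count i (a : Multiset σ)
        then f a else 0) = Multiset.count i (a : Multiset σ) • f a := by
      rw [← Finset.sum_filter, Finset.sum_const]
      congr 1
      have hle : Multiset.count i (a : Multiset σ) ≤ d :=
        (Multiset.count_le_card _ _).trans a.2.le
      have : (Finset.range d).filter (fun m => m + 1 ≤ Multiset.count i (a : Multiset σ)) =
          Finset.range (Multiset.count i (a : Multiset σ)) := by
        ext m
        simp only [Finset.mem_filter, Finset.mem_range]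
        omega
      rw [this, Finset.card_range]
    simp_rw [hi]
    rw [← Finset.sum_smul, Multiset.sum_count_eq_card fun _ _ => Finset.mem_univ _]
    exact congrArg (· • f a) a.2.symm
  rw [Finset.smul_sum, Finset.sum_congr rfl fun a _ => hcount a, Finset.sum_comm]
  refine Finset.sum_congr rfl fun m hm => ?_
  rw [Finset.sum_comm]
  refine Finset.sum_congr rfl fun i _ => ?_
  rw [← Finset.sum_filter, sum_sym_filter_le_count (Finset.mem_range.1 hm)]

theorem nsmul_sum_sym_pow {S : Type*} [CommRing S] (x : σ → S) (d k : ℕ) :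
    d • ∑ a : Sym σ d, ((a : Multiset σ).map x).sum ^ k =
      ∑ m ∈ Finset.range d, ∑ j ∈ Finset.range (k + 1),
        ((m + 1) ^ j * k.choose j) • ((∑ i, x i ^ j) *
          ∑ a : Sym σ (d - (m + 1)), ((a : Multiset σ).map x).sum ^ (k - j)) := by
  rw [nsmul_sum_sym d fun s => (s.map x).sum ^ k]
  refine Finset.sum_congr rfl fun m _ => ?_
  have h (i : σ) (a : Sym σ (d - (m + 1))) :
      (((a : Multiset σ) + Multiset.replicate (m + 1) i).map x).sum ^ k =
        ∑ j ∈ Finset.range (k + 1), ((m + 1) ^ j * k.choose j) •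
          (x i ^ j * ((a : Multiset σ).map x).sum ^ (k - j)) := by
    rw [Multiset.map_add, Multiset.sum_add, add_comm, add_pow]
    refine Finset.sum_congr rfl fun j _ => ?_
    simp only [Multiset.map_replicate, Multiset.sum_replicate, nsmul_eq_mul, mul_pow]
    push_cast
    ring
  simp_rw [h, Finset.sum_mul_sum, Finset.smul_sum]
  rw [Finset.sum_congr rfl fun i _ => Finset.sum_comm, Finset.sum_comm]

/-- The power sums of the weights of a symmetric power are, up to lower terms, positive multiples
of the power sums of the variables. -/
theorem exists_sum_sym_pow_sub_smul_mem {K S : Type*} [Field K] [CharZero K] [CommRing S]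
    [Algebra K S] (x : σ → S) (A : Subalgebra K S) (d k : ℕ) (hk : 0 < k)
    (hA : ∀ j, 0 < j → j < k → ∑ i, x i ^ j ∈ A) :
    ∃ c : ℚ, 0 ≤ c ∧ (0 < d → Nonempty σ → 0 < c) ∧
      ∑ a : Sym σ d, ((a : Multiset σ).map x).sum ^ k - (c : K) • ∑ i, x i ^ k ∈ A := by
  induction d using Nat.strong_induction_on generalizing k with
  | _ d ih =>
  obtain rfl | hd := d.eq_zero_or_pos
  · refine ⟨0, le_rfl, by simp, ?_⟩
    have (a : Sym σ 0) : (a : Multiset σ) = 0 := by rw [Sym.eq_nil_of_card_zero a]; rfl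
    simp [this, hk.ne']
  obtain ⟨k, rfl⟩ := Nat.exists_eq_succ_of_ne_zero hk.ne'
  have hterm (m : ℕ) (hm : m ∈ Finset.range d) : ∃ q : ℚ, 0 ≤ q ∧ (Nonempty σ → 0 < q) ∧
      ∑ j ∈ Finset.range (k + 1 + 1), ((m + 1) ^ j * (k + 1).choose j) • ((∑ i, x i ^ j) *
        ∑ a : Sym σ (d - (m + 1)), ((a : Multiset σ).map x).sum ^ (k + 1 - j)) -
        (q : K) • ∑ i, x i ^ (k + 1) ∈ A := by
    have hlt : d - (m + 1) < d := by omega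
    obtain ⟨c, hc, -, hcA⟩ := ih _ hlt (k + 1) hk hA
    refine ⟨Fintype.card σ * c + (m + 1) ^ (k + 1) * Fintype.card (Sym σ (d - (m + 1))),
      by positivity, fun hσ => ?_, ?_⟩
    · have : 0 < Fintype.card (Sym σ (d - (m + 1))) :=
        Fintype.card_pos_iff.2 (hσ.map (Sym.replicate _))
      positivity
    · rw [Finset.sum_range_succ, Finset.sum_range_succ']
      have hmid : ∑ j ∈ Finset.range k, ((m + 1) ^ (j + 1) * (k + 1).choose (j + 1)) •
          ((∑ i, x i ^ (j + 1)) * ∑ a : Sym σ (d - (m + 1)),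
            ((a : Multiset σ).map x).sum ^ (k + 1 - (j + 1))) ∈ A := by
        refine sum_mem fun j hj => nsmul_mem (mul_mem ?_ ?_) _
        · exact hA _ j.succ_pos (by simpa using hj)
        · have hj' := Finset.mem_range.1 hj
          obtain ⟨c', -, -, hc'⟩ := ih _ hlt (k + 1 - (j + 1)) (by omega)
            fun l hl hlk => hA l hl (by omega)
          have := add_mem hc' (A.smul_mem (hA (k + 1 - (j + 1)) (by omega) (by omega)) (c' : K))
          simpa using this
      convert add_mem hmid (nsmul_mem hcA (Fintype.card σ)) using 1
      simp only [Algebra.smul_def]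
      simp
      ring
  choose! q hq hq' hqA using hterm
  refine ⟨(d : ℚ)⁻¹ * ∑ m ∈ Finset.range d, q m,
    mul_nonneg (by positivity) (Finset.sum_nonneg hq), fun _ hσ => mul_pos (by positivity)
      (Finset.sum_pos (fun m hm => hq' m hm hσ) (Finset.nonempty_range_iff.2 hd.ne')), ?_⟩
  have hd' : (d : K) ≠ 0 := by exact_mod_cast hd.ne'
  have := A.smul_mem (sum_mem hqA) ((d : K)⁻¹)
  rw [Finset.sum_sub_distrib, ← nsmul_sum_sym_pow, ← Finset.sum_smul, smul_sub,
    ← Nat.cast_smul_eq_nsmul K, smul_smul, smul_smul, inv_mul_cancel₀ hd', one_smul] at this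
  push_cast
  exact this

end PowerSums

section Symmetric

variable {K S : Type*} [Field K] [CommRing S] [Algebra K S]

theorem aeval_mem_of_isSymmetric {τ : Type*} [Fintype τ] (w : τ → S) (A : Subalgebra K S)
    (h : ∀ j, aeval w (esymm τ K j) ∈ A) {p : MvPolynomial τ K} (hp : p.IsSymmetric) :
    aeval w p ∈ A := by
  obtain ⟨q, hq⟩ := esymmAlgHom_surjective K (σ := τ) le_rfl ⟨p, hp⟩
  have hp' : p = aeval (fun i : Fin (Fintype.card τ) => esymm τ K (i + 1)) q := by
    rw [← esymmAlgHom_apply, hq]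
  rw [hp', ← AlgHom.comp_apply, comp_aeval]
  have hle : (aeval (R := K) fun i : Fin (Fintype.card τ) =>
      aeval w (esymm τ K (i + 1))).range ≤ A := by
    rw [← Algebra.adjoin_range_eq_range_aeval]
    exact Algebra.adjoin_le (Set.range_subset_iff.2 fun i => h _)
  exact hle (AlgHom.mem_range_self _ q)

theorem esymm_mem_of_psum_mem [CharZero K] {σ : Type*} [Fintype σ]
    (A : Subalgebra K (MvPolynomial σ K)) (h : ∀ k, 0 < k → psum σ K k ∈ A) (k : ℕ) :
    esymm σ K k ∈ A := by
  induction k using Nat.strong_induction_on with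
  | _ k ih =>
  obtain rfl | hk := k.eq_zero_or_pos
  · simp
  have hmem : (k : MvPolynomial σ K) * esymm σ K k ∈ A := by
    rw [mul_esymm_eq_sum]
    refine mul_mem (pow_mem (neg_mem (one_mem _)) _) (sum_mem fun a ha => ?_)
    obtain ⟨hsum, hlt⟩ := Finset.mem_filter.1 ha
    rw [Finset.HasAntidiagonal.mem_antidiagonal] at hsum
    exact mul_mem (mul_mem (pow_mem (neg_mem (one_mem _)) _) (ih _ hlt)) (h _ (by omega))
  have hk' : (k : K) ≠ 0 := by exact_mod_cast hk.ne'
  have := A.smul_mem hmem ((k : K)⁻¹)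
  rwa [← nsmul_eq_mul, ← Nat.cast_smul_eq_nsmul K, smul_smul, inv_mul_cancel₀ hk',
    one_smul] at this

theorem aeval_esymm_mem_adjoin_coeff {τ : Type*} [Fintype τ] (w : τ → S) (j : ℕ) :
    aeval w (esymm τ K j) ∈ Algebra.adjoin K
      (Set.range (∏ a, (Polynomial.X + Polynomial.C (w a))).coeff) := by
  obtain hj | hj := le_or_gt j (Fintype.card τ)
  · refine Algebra.subset_adjoin ⟨Fintype.card τ - j, ?_⟩
    rw [Finset.prod_X_add_C_coeff _ _ (by simp), aeval_esymm_eq_multiset_esymm,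
      Finset.esymm_map_val, Finset.card_univ, Nat.sub_sub_self hj]
  · rw [aeval_esymm_eq_multiset_esymm, Finset.esymm_map_val,
      Finset.powersetCard_eq_empty.2 (by simpa using hj)]
    simp

end Symmetric

theorem adjoin_coeff_prod_sym {K σ : Type*} [Field K] [CharZero K] [Fintype σ] [DecidableEq σ]
    (d : ℕ) (hd : 0 < d) :
    Algebra.adjoin K (Set.range (∏ a : Sym σ d, (Polynomial.X + Polynomial.C
      ((a : Multiset σ).map (X : σ → MvPolynomial σ K)).sum)).coeff) =
      symmetricSubalgebra σ K := by
  apply le_antisymm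
  · refine Algebra.adjoin_le ?_
    rintro _ ⟨k, rfl⟩
    refine (mem_symmetricSubalgebra _).2 fun e => ?_
    rw [← AlgHom.coe_toRingHom, ← Polynomial.coeff_map, Polynomial.map_prod]
    congr 1
    refine Fintype.prod_equiv (Sym.equivCongr e) _ _ fun a => ?_
    simp only [Polynomial.map_add, Polynomial.map_X, Polynomial.map_C]
    congr 2
    simp [Sym.equivCongr, map_multiset_sum]
  · intro p hp
    set A := Algebra.adjoin K (Set.range (∏ a : Sym σ d, (Polynomial.X + Polynomial.C
      ((a : Multiset σ).map (X : σ → MvPolynomial σ K)).sum)).coeff)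
    have hP (k : ℕ) : ∑ a : Sym σ d,
        ((a : Multiset σ).map (X : σ → MvPolynomial σ K)).sum ^ k ∈ A := by
      have := aeval_mem_of_isSymmetric _ A (aeval_esymm_mem_adjoin_coeff (K := K) _)
        (psum_isSymmetric (Sym σ d) K k)
      simpa [psum] using this
    have hp' (k : ℕ) (hk : 0 < k) : psum σ K k ∈ A := by
      induction k using Nat.strong_induction_on with
      | _ k ih =>
      cases isEmpty_or_nonempty σ with
      | inl h => simp [psum]
      | inr h =>
        obtain ⟨c, -, hc, hcA⟩ := exists_sum_sym_pow_sub_smul_mem (K := K)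
          (X : σ → MvPolynomial σ K) A d k hk fun j hj hjk => ih j hjk hj
        have hc' : (c : K) ≠ 0 := by exact_mod_cast (hc hd h).ne'
        have := A.smul_mem (sub_mem (hP k) hcA) ((c : K)⁻¹)
        rwa [sub_sub_cancel, smul_smul, inv_mul_cancel₀ hc', one_smul] at this
    have := aeval_mem_of_isSymmetric (X : σ → MvPolynomial σ K) A
      (fun j => by simpa using esymm_mem_of_psum_mem A hp' j) hp
    simpa using this

/-- the coefficient algebra of `ut_n(ℂ)` on `S^d(ℂ^n)` equals the algebra of
symmetric polynomials in the diagonal variables `x₁ = x_{11}, …, x_n = x_{nn}`. -/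
theorem coeffAlg_ut_symPow (n d : ℕ) (hn : 2 ≤ n) (hd : 1 ≤ d) :
    coeffAlg ℂ (symMat n d (utGen n)) =
      (MvPolynomial.symmetricSubalgebra (Fin n) ℂ).map
        (MvPolynomial.rename fun i : Fin n => (⟨(i, i), le_rfl⟩ : UTIdx n)) := by
  rw [← adjoin_coeff_prod_sym d hd, AlgHom.map_adjoin, ← Set.range_comp, coeffAlg,
    charP_symMat fun i j hij => dif_neg (not_le.2 hij)]
  congr 2
  funext k
  rw [Function.comp_apply, ← AlgHom.coe_toRingHom, ← Polynomial.coeff_map, Polynomial.map_prod]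
  congr 1
  refine Finset.prod_congr rfl fun a _ => ?_
  simp only [Polynomial.map_add, Polynomial.map_X, Polynomial.map_C]
  congr 2
  simp [map_multiset_sum, utGen]
  rfl
end
end

section
/- Let n ≥ 2 and d ≥ 1. With respect to the standard basis {E_{ij} : 1 ≤ i,j ≤ n} of gl_n(C) (with variable x_{ij} attached to E_{ij}), the coefficient algebra B_{gl_n(C)}(S^d(C^n)) equals the invariant ring C[x_{ij} : 1 ≤ i,j ≤ n]^{GL_n(C)} of the conjugation action of GL_n(C) on gl_n(C), and this invariant ring equals the polynomial subalgebra C[Tr_1, Tr_2, …, Tr_n], where Tr_i := Tr(X^i) is the trace of the i-th power of the generic matrix X = (x_{ij}). -/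
open MvPolynomial Matrix

noncomputable section

/-- The generic `n × n` matrix `X = (x_{ij})`. -/
def glGen (n : ℕ) : Matrix (Fin n) (Fin n) (MvPolynomial (Fin n × Fin n) ℂ) :=
  fun i j => MvPolynomial.X (i, j)

/-- The algebra endomorphism of `ℂ[x_{ij}]` induced by the conjugation action of
`g ∈ GL_n(ℂ)` on the space of `n × n` matrices: it substitutes the variable `x_{ij}` by the
`(i,j)` entry of `g·X·g⁻¹`. -/
def glConj {n : ℕ} (g : GL (Fin n) ℂ) :
    MvPolynomial (Fin n × Fin n) ℂ →ₐ[ℂ] MvPolynomial (Fin n × Fin n) ℂ :=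
  MvPolynomial.aeval fun p : Fin n × Fin n =>
    (((((g : Matrix (Fin n) (Fin n) ℂ).map MvPolynomial.C) * glGen n *
      (((g⁻¹ : GL (Fin n) ℂ) : Matrix (Fin n) (Fin n) ℂ).map MvPolynomial.C)) :
        Matrix (Fin n) (Fin n) (MvPolynomial (Fin n × Fin n) ℂ)) p.1 p.2)

/-- The invariant ring `ℂ[gl_n(ℂ)]^{GL_n(ℂ)}` of the conjugation action. -/
def glInvariants (n : ℕ) : Subalgebra ℂ (MvPolynomial (Fin n × Fin n) ℂ) where
  carrier := {f | ∀ g : GL (Fin n) ℂ, glConj g f = f}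
  mul_mem' := by intro a b ha hb g; rw [_root_.map_mul, ha g, hb g]
  add_mem' := by intro a b ha hb g; rw [_root_.map_add, ha g, hb g]
  one_mem' := by intro g; rw [_root_.map_one]
  zero_mem' := by intro g; rw [_root_.map_zero]
  algebraMap_mem' := by intro r g; exact AlgHom.commutes _ r

section PowerSums

variable {σ A : Type*} [Fintype σ] [DecidableEq σ] [CommRing A]

/-- The sum over all multisets of size `d` of the `k`-th powers of the sums of their weights. -/
def symPowerSum (y : σ → A) (d k : ℕ) : A :=
  ∑ a : Sym σ d, ((a : Multiset σ).map y).sum ^ k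

lemma sum_sym_count_ge (F : Multiset σ → A) (i : σ) {d m : ℕ} (hm : m ≤ d) :
    (∑ a : Sym σ d, if m ≤ (a : Multiset σ).count i then F a else 0) =
      ∑ b : Sym σ (d - m), F ((b : Multiset σ) + Multiset.replicate m i) := by
  rw [← Finset.sum_filter]
  symm
  refine Finset.sum_bij
    (fun b _ => Sym.mk ((b : Multiset σ) + Multiset.replicate m i) (by simp; omega)) ?_ ?_ ?_ ?_
  · intro b _
    simp
  · intro b _ c _ h
    have := congrArg (fun s : Sym σ d => (s : Multiset σ)) h
    simpa using this
  · intro a ha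
    have hle : Multiset.replicate m i ≤ (a : Multiset σ) := by
      rw [← Multiset.le_count_iff_replicate_le]
      simpa using ha
    refine ⟨Sym.mk ((a : Multiset σ) - Multiset.replicate m i) ?_, Finset.mem_univ _, ?_⟩
    · rw [Multiset.card_sub hle]; simp
    · ext1
      simp [tsub_add_cancel_of_le hle]
  · intro b _
    rfl

lemma natCast_mul_symPowerSum (y : σ → A) (d k : ℕ) :
    (d : A) * symPowerSum y d k = ∑ m ∈ Finset.Icc 1 d, ∑ r ∈ Finset.range (k + 1),
      ((m : A) ^ r * (k.choose r : A)) * ((∑ i, y i ^ r) * symPowerSum y (d - m) (k - r)) := by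
  have hcount (a : Sym σ d) : (d : A) =
      ∑ m ∈ Finset.Icc 1 d, ∑ i, if m ≤ (a : Multiset σ).count i then (1 : A) else 0 := by
    rw [Finset.sum_comm]
    have (i : σ) : (∑ m ∈ Finset.Icc 1 d, if m ≤ (a : Multiset σ).count i then (1 : A) else 0) =
        ((a : Multiset σ).count i : A) := by
      have hle : (a : Multiset σ).count i ≤ d := by
        simpa using Multiset.count_le_card i (a : Multiset σ)
      rw [← Finset.sum_filter, Finset.sum_const, nsmul_one]
      congr 1
      have : (Finset.Icc 1 d).filter (· ≤ (a : Multiset σ).count i) =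
          Finset.Icc 1 ((a : Multiset σ).count i) := by
        ext m; simp; omega
      rw [this]; simp
    simp_rw [this]
    rw [← Nat.cast_sum, Multiset.sum_count_eq_card (fun _ _ => Finset.mem_univ _)]
    simp
  calc (d : A) * symPowerSum y d k
      = ∑ m ∈ Finset.Icc 1 d, ∑ i, ∑ a : Sym σ d, if m ≤ (a : Multiset σ).count i then
          ((a : Multiset σ).map y).sum ^ k else 0 := by
        unfold symPowerSum
        rw [Finset.mul_sum]
        conv_lhs =>
          enter [2, a]
          rw [hcount a, Finset.sum_mul]
          enter [2, m]
          rw [Finset.sum_mul]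
        simp only [ite_mul, one_mul, zero_mul]
        rw [Finset.sum_comm]
        refine Finset.sum_congr rfl fun m _ => ?_
        rw [Finset.sum_comm]
    _ = _ := by
        refine Finset.sum_congr rfl fun m hm => ?_
        have hm' := (Finset.mem_Icc.mp hm).2
        simp_rw [sum_sym_count_ge (fun s => (s.map y).sum ^ k) _ hm']
        simp only [Multiset.map_add, Multiset.sum_add, Multiset.map_replicate,
          Multiset.sum_replicate, nsmul_eq_mul]
        simp_rw [add_comm (Multiset.sum _), add_pow, symPowerSum, mul_pow, Finset.sum_mul_sum,
          Finset.mul_sum]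
        conv_lhs =>
          enter [2, i]
          rw [Finset.sum_comm]
        rw [Finset.sum_comm]
        refine Finset.sum_congr rfl fun r _ => Finset.sum_congr rfl fun i _ =>
          Finset.sum_congr rfl fun b _ => ?_
        ring

lemma symPowerSum_zero (y : σ → A) (k : ℕ) : symPowerSum y 0 k = 0 ^ k := by
  have (a : Sym σ 0) : (a : Multiset σ) = 0 := Multiset.card_eq_zero.mp a.2
  simp [symPowerSum, this]

variable [Algebra ℂ A]

lemma Subalgebra.mem_of_natCast_mul_mem (S : Subalgebra ℂ A) {d : ℕ} (hd : d ≠ 0) {x : A}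
    (h : (d : A) * x ∈ S) : x ∈ S := by
  have := S.smul_mem h ((d : ℂ)⁻¹)
  rwa [← nsmul_eq_mul, ← Nat.cast_smul_eq_nsmul ℂ, smul_smul, inv_mul_cancel₀ (by simpa), one_smul]
    at this

lemma symPowerSum_mem (S : Subalgebra ℂ A) (y : σ → A) (j : ℕ)
    (h : ∀ r ≤ j, ∑ i, y i ^ r ∈ S) (d : ℕ) : symPowerSum y d j ∈ S := by
  induction d using Nat.strong_induction_on generalizing j with
  | _ d ih =>
    rcases Nat.eq_zero_or_pos d with rfl | hd
    · rw [symPowerSum_zero]; exact S.pow_mem S.zero_mem _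
    · refine S.mem_of_natCast_mul_mem hd.ne' ?_
      rw [natCast_mul_symPowerSum]
      refine S.sum_mem fun m hm => S.sum_mem fun r hr => ?_
      rw [Finset.mem_Icc] at hm
      rw [Finset.mem_range] at hr
      refine S.mul_mem (S.mul_mem (S.pow_mem (S.natCast_mem _) _) (S.natCast_mem _))
        (S.mul_mem (h _ (by omega)) (ih _ (by omega) _ fun s hs => h s (by omega)))

lemma exists_symPowerSum_sub_mem (S : Subalgebra ℂ A) (y : σ → A) {k : ℕ} (hk : k ≠ 0)
    (h : ∀ r < k, ∑ i, y i ^ r ∈ S) (d : ℕ) :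
    ∃ c : ℚ, 0 ≤ c ∧ (0 < d → 0 < c) ∧
      symPowerSum y d k - (c : ℂ) • ∑ i, y i ^ k ∈ S := by
  induction d using Nat.strong_induction_on with
  | _ d ih =>
    rcases Nat.eq_zero_or_pos d with rfl | hd
    · exact ⟨0, le_rfl, by simp, by simp [symPowerSum_zero, hk]⟩
    choose! c hc0 _ hcS using ih
    refine ⟨(d : ℚ)⁻¹ * ∑ m ∈ Finset.Icc 1 d,
      (Fintype.card σ * c (d - m) + (m : ℚ) ^ k * Fintype.card (Sym σ (d - m))), ?_, ?_, ?_⟩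
    · refine mul_nonneg (by positivity) (Finset.sum_nonneg fun m hm => ?_)
      rw [Finset.mem_Icc] at hm
      have := hc0 (d - m) (by omega)
      positivity
    · intro _
      refine mul_pos (by positivity) (Finset.sum_pos' (fun m hm => ?_) ⟨d, by simp; omega, ?_⟩)
      · rw [Finset.mem_Icc] at hm
        have := hc0 (d - m) (by omega)
        positivity
      · have := hc0 (d - d) (by omega)
        have : 0 < Fintype.card (Sym σ (d - d)) := by
          rw [Nat.sub_self]; exact Fintype.card_pos
        positivity
    · refine S.mem_of_natCast_mul_mem hd.ne' ?_
      have key : (d : A) * (symPowerSum y d k - (((d : ℚ)⁻¹ * ∑ m ∈ Finset.Icc 1 d,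
          (Fintype.card σ * c (d - m) + (m : ℚ) ^ k * Fintype.card (Sym σ (d - m))) : ℚ) : ℂ) •
            ∑ i, y i ^ k) = ∑ m ∈ Finset.Icc 1 d,
          ((Fintype.card σ : A) * (symPowerSum y (d - m) k - (c (d - m) : ℂ) • ∑ i, y i ^ k) +
            ∑ r ∈ Finset.Ico 1 k, ((m : A) ^ r * (k.choose r : A)) *
              ((∑ i, y i ^ r) * symPowerSum y (d - m) (k - r))) := by
        rw [mul_sub, natCast_mul_symPowerSum]
        have hs : (d : A) * ((((d : ℚ)⁻¹ * ∑ m ∈ Finset.Icc 1 d,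
            (Fintype.card σ * c (d - m) + (m : ℚ) ^ k * Fintype.card (Sym σ (d - m))) : ℚ) : ℂ) •
            ∑ i, y i ^ k) = ∑ m ∈ Finset.Icc 1 d,
            ((Fintype.card σ : A) * ((c (d - m) : ℂ) • ∑ i, y i ^ k) +
              (m : A) ^ k * (Fintype.card (Sym σ (d - m)) : A) * ∑ i, y i ^ k) := by
          rw [← nsmul_eq_mul, ← Nat.cast_smul_eq_nsmul ℂ, smul_smul]
          push_cast
          rw [mul_inv_cancel_left₀ (by exact_mod_cast hd.ne'), Finset.sum_smul]
          refine Finset.sum_congr rfl fun m _ => ?_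
          simp only [Algebra.smul_def, map_add, map_mul, map_pow, map_natCast]
          ring
        rw [hs, ← Finset.sum_sub_distrib]
        refine Finset.sum_congr rfl fun m _ => ?_
        rw [Finset.sum_range_succ, Finset.range_eq_Ico, Finset.sum_eq_sum_Ico_succ_bot (by omega)]
        simp only [symPowerSum, pow_zero, Finset.sum_const, Finset.card_univ, nsmul_eq_mul, mul_one,
          Nat.choose_zero_right, Nat.cast_one, Nat.sub_zero, one_mul, Nat.choose_self, Nat.sub_self]
        ring
      rw [key]
      refine S.sum_mem fun m hm => ?_
      rw [Finset.mem_Icc] at hm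
      refine S.add_mem (S.mul_mem (S.natCast_mem _) (hcS _ (by omega))) (S.sum_mem fun r hr => ?_)
      rw [Finset.mem_Ico] at hr
      exact S.mul_mem (S.mul_mem (S.pow_mem (S.natCast_mem _) _) (S.natCast_mem _))
        (S.mul_mem (h _ hr.2) (symPowerSum_mem S y _ (fun s hs => h s (by omega)) _))

lemma sum_pow_mem_of_symPowerSum_mem (S : Subalgebra ℂ A) (y : σ → A) {d : ℕ} (hd : 0 < d)
    (h : ∀ k, symPowerSum y d k ∈ S) (k : ℕ) : ∑ i, y i ^ k ∈ S := by
  induction k using Nat.strong_induction_on with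
  | _ k ih =>
    rcases eq_or_ne k 0 with rfl | hk
    · simp
    obtain ⟨c, _, hc, hmem⟩ := exists_symPowerSum_sub_mem S y hk ih d
    have := S.smul_mem (S.sub_mem (h k) hmem) ((c : ℂ)⁻¹)
    rwa [sub_sub_cancel, smul_smul, inv_mul_cancel₀ (by exact_mod_cast (hc hd).ne'), one_smul]
      at this

end PowerSums

section Symmetric

variable {σ : Type*} [Fintype σ]

lemma symmetricSubalgebra_le_of_psum_mem
    (S : Subalgebra ℂ (MvPolynomial σ ℂ))
    (h : ∀ k, 1 ≤ k → k ≤ Fintype.card σ → psum σ ℂ k ∈ S) : symmetricSubalgebra σ ℂ ≤ S := by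
  have hesymm (k : ℕ) (hk : k ≤ Fintype.card σ) : esymm σ ℂ k ∈ S := by
    induction k using Nat.strong_induction_on with
    | _ k ih =>
      rcases Nat.eq_zero_or_pos k with rfl | hk0
      · simp
      have hmem : (k : MvPolynomial σ ℂ) * esymm σ ℂ k ∈ S := by
        rw [mul_esymm_eq_sum]
        have hneg : (-1 : MvPolynomial σ ℂ) ∈ S := S.neg_mem S.one_mem
        refine S.mul_mem (S.pow_mem hneg _) (S.sum_mem fun a ha => ?_)
        rw [Finset.mem_filter, Finset.HasAntidiagonal.mem_antidiagonal] at ha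
        exact S.mul_mem (S.mul_mem (S.pow_mem hneg _) (ih _ ha.2 (by omega)))
          (h _ (by omega) (by omega))
      have := S.smul_mem hmem ((k : ℂ)⁻¹)
      rwa [← nsmul_eq_mul, ← Nat.cast_smul_eq_nsmul ℂ, smul_smul, inv_mul_cancel₀,
        one_smul] at this
      exact_mod_cast hk0.ne'
  intro f hf
  obtain ⟨q, hq⟩ := esymmAlgHom_surjective (σ := σ) ℂ le_rfl ⟨f, hf⟩
  have hq' := congrArg Subtype.val hq
  rw [esymmAlgHom_apply] at hq'
  have hle :
      Algebra.adjoin ℂ (Set.range fun i : Fin (Fintype.card σ) => esymm σ ℂ (i + 1)) ≤ S := by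
    rw [Algebra.adjoin_le_iff]
    rintro _ ⟨i, rfl⟩
    exact hesymm _ i.2
  refine hle ?_
  rw [Algebra.adjoin_range_eq_range_aeval, AlgHom.mem_range]
  exact ⟨q, hq'⟩

lemma aeval_mem_of_isSymmetric_s1 {A : Type*} [CommRing A] [Algebra ℂ A] (S : Subalgebra ℂ A)
    (y : σ → A) (h : ∀ k ≤ Fintype.card σ, aeval y (esymm σ ℂ k) ∈ S) {f : MvPolynomial σ ℂ}
    (hf : f.IsSymmetric) : aeval y f ∈ S := by
  obtain ⟨q, hq⟩ := esymmAlgHom_surjective (σ := σ) ℂ le_rfl ⟨f, hf⟩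
  have hq' := congrArg Subtype.val hq
  rw [esymmAlgHom_apply] at hq'
  have hle : Algebra.adjoin ℂ (Set.range fun i : Fin (Fintype.card σ) => esymm σ ℂ (i + 1)) ≤
      S.comap (aeval y) := by
    rw [Algebra.adjoin_le_iff]
    rintro _ ⟨i, rfl⟩
    exact h _ i.2
  refine hle ?_
  rw [Algebra.adjoin_range_eq_range_aeval, AlgHom.mem_range]
  exact ⟨q, hq'⟩

lemma sum_pow_mem_of_coeff_mem {A : Type*} [CommRing A] [Algebra ℂ A] (S : Subalgebra ℂ A)
    (y : σ → A) (h : ∀ k, (∏ a, (Polynomial.X + Polynomial.C (y a))).coeff k ∈ S) (k : ℕ) :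
    ∑ a, y a ^ k ∈ S := by
  have : ∑ a, y a ^ k = aeval y (psum σ ℂ k) := by simp [psum]
  rw [this]
  refine aeval_mem_of_isSymmetric_s1 S y (fun j hj => ?_) (psum_isSymmetric σ ℂ k)
  have := h (Fintype.card σ - j)
  rw [Finset.prod_X_add_C_coeff _ _ (by simp), Finset.card_univ, Nat.sub_sub_self hj] at this
  simpa [esymm] using this

lemma adjoin_psum_eq_symmetricSubalgebra (n : ℕ) :
    Algebra.adjoin ℂ (Set.range fun i : Fin n => psum (Fin n) ℂ (i + 1)) =
      symmetricSubalgebra (Fin n) ℂ := by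
  refine le_antisymm ?_ (symmetricSubalgebra_le_of_psum_mem _ fun k hk hkn => ?_)
  · rw [Algebra.adjoin_le_iff]
    rintro _ ⟨i, rfl⟩
    exact psum_isSymmetric _ _ _
  · rw [Fintype.card_fin] at hkn
    refine Algebra.subset_adjoin ⟨⟨k - 1, by omega⟩, ?_⟩
    simp [Nat.sub_add_cancel hk]

lemma algebraicIndependent_psum (n : ℕ) :
    AlgebraicIndependent ℂ fun i : Fin n => psum (Fin n) ℂ (i + 1) := by
  let e := esymmAlgEquiv (Fin n) ℂ (Fintype.card_fin n)
  let p : Fin n → symmetricSubalgebra (Fin n) ℂ := fun i =>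
    ⟨psum (Fin n) ℂ (i + 1), psum_isSymmetric _ _ _⟩
  have hp : Algebra.adjoin ℂ (Set.range p) = ⊤ := by
    apply Subalgebra.map_injective (f := (symmetricSubalgebra (Fin n) ℂ).val)
      Subtype.val_injective
    rw [AlgHom.map_adjoin, ← Set.range_comp, Algebra.map_top, Subalgebra.range_val]
    exact adjoin_psum_eq_symmetricSubalgebra n
  have hq : Algebra.adjoin ℂ (Set.range (e.symm ∘ p)) = ⊤ := by
    have := congrArg (Subalgebra.map (e.symm : _ →ₐ[ℂ] MvPolynomial (Fin n) ℂ)) hp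
    rw [AlgHom.map_adjoin, ← Set.range_comp, Algebra.map_top,
      (AlgHom.range_eq_top _).mpr e.symm.surjective] at this
    exact this
  have halg : Algebra.IsAlgebraic (Algebra.adjoin ℂ (Set.range (e.symm ∘ p)))
      (MvPolynomial (Fin n) ℂ) := by
    rw [hq]
    exact ⟨fun x => isAlgebraic_algebraMap (⟨x, trivial⟩ : (⊤ : Subalgebra ℂ _))⟩
  have hind := (Algebra.IsAlgebraic.isTranscendenceBasis_of_le_trdeg_of_finite (R := ℂ) (e.symm ∘ p)
    (by rw [MvPolynomial.trdeg_of_isDomain]; simp)).1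
  have := hind.map' (f := (symmetricSubalgebra (Fin n) ℂ).val.comp e.toAlgHom)
    (Subtype.val_injective.comp e.injective)
  convert! this using 1
  ext1 i
  simp [p]

end Symmetric

section SymmetricPower

/-- The derivation of the polynomial ring by which a matrix acts. -/
def linDer {n : ℕ} (A : Matrix (Fin n) (Fin n) ℂ) :
    Derivation ℂ (MvPolynomial (Fin n) ℂ) (MvPolynomial (Fin n) ℂ) :=
  mkDerivation ℂ fun i => ∑ j, C (A i j) * X j

/-- The linear substitution given by a matrix. -/
def linSubst {n : ℕ} (g : Matrix (Fin n) (Fin n) ℂ) :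
    MvPolynomial (Fin n) ℂ →ₐ[ℂ] MvPolynomial (Fin n) ℂ :=
  aeval fun i => ∑ j, C (g i j) * X j

/-- The monomial attached to a multiset of variables. -/
def symMonomial {n d : ℕ} (a : Sym (Fin n) d) : MvPolynomial (Fin n) ℂ :=
  monomial (Multiset.toFinsupp (a : Multiset (Fin n))) 1

/-- The matrix of `linSubst g` in degree `d`. -/
def symSubstMat {n : ℕ} (d : ℕ) (g : Matrix (Fin n) (Fin n) ℂ) :
    Matrix (Sym (Fin n) d) (Sym (Fin n) d) ℂ :=
  fun a b => coeff (Multiset.toFinsupp (b : Multiset (Fin n))) (linSubst g (symMonomial a))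

variable {n d : ℕ}

lemma linDer_X (A : Matrix (Fin n) (Fin n) ℂ) (i : Fin n) :
    linDer A (X i) = ∑ j, C (A i j) * X j := by
  simp [linDer]

lemma linSubst_X (g : Matrix (Fin n) (Fin n) ℂ) (i : Fin n) :
    linSubst g (X i) = ∑ j, C (g i j) * X j := by
  simp [linSubst]

lemma linDer_linSubst {g A B : Matrix (Fin n) (Fin n) ℂ} (h : g * A = B * g)
    (p : MvPolynomial (Fin n) ℂ) : linDer A (linSubst g p) = linSubst g (linDer B p) := by
  induction p using MvPolynomial.induction_on with
  | C a =>
    rw [← algebraMap_eq, AlgHom.commutes, Derivation.map_algebraMap, Derivation.map_algebraMap,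
      map_zero]
  | add p q hp hq => simp [hp, hq]
  | mul_X p i hp =>
    have hX : linDer A (linSubst g (X i)) = linSubst g (linDer B (X i)) := by
      have hij (k : Fin n) : ∑ j, g i j * A j k = ∑ j, B i j * g j k := by
        simpa [Matrix.mul_apply] using congrFun (congrFun h i) k
      simp only [linDer_X, linSubst_X, map_sum, Derivation.leibniz, map_mul, smul_eq_mul,
        ← algebraMap_eq, AlgHom.commutes, Derivation.map_algebraMap, mul_zero, add_zero,
        Finset.mul_sum]
      rw [Finset.sum_comm]
      conv_rhs => rw [Finset.sum_comm]
      refine Finset.sum_congr rfl fun k _ => ?_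
      simp_rw [← mul_assoc, ← Finset.sum_mul, ← map_mul, ← map_sum, hij]
    rw [map_mul, Derivation.leibniz, Derivation.leibniz, map_add, hp, hX]
    simp

lemma linSubst_linSubst (g h : Matrix (Fin n) (Fin n) ℂ) (p : MvPolynomial (Fin n) ℂ) :
    linSubst g (linSubst h p) = linSubst (h * g) p := by
  have : (linSubst g).comp (linSubst h) = linSubst (h * g) := by
    ext1 i
    simp only [AlgHom.comp_apply, linSubst_X, map_sum, map_mul, ← algebraMap_eq, AlgHom.commutes,
      Finset.mul_sum, Matrix.mul_apply, Finset.sum_mul]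
    rw [Finset.sum_comm]
    simp [mul_assoc]
  exact DFunLike.congr_fun this p

lemma coeff_symMonomial (a b : Sym (Fin n) d) :
    coeff (Multiset.toFinsupp (b : Multiset (Fin n))) (symMonomial a) = if a = b then 1 else 0 := by
  simp [symMonomial, coeff_monomial]

lemma eq_sum_coeff_mul_symMonomial {p : MvPolynomial (Fin n) ℂ} (hp : p.IsHomogeneous d) :
    p = ∑ b : Sym (Fin n) d,
      C (coeff (Multiset.toFinsupp (b : Multiset (Fin n))) p) * symMonomial b := by
  ext m
  simp only [coeff_sum, coeff_C_mul, symMonomial, coeff_monomial, mul_ite, mul_one, mul_zero]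
  by_cases hm : m.degree = d
  · have hcard : Multiset.card (Finsupp.toMultiset m) = d := by
      rw [Finsupp.card_toMultiset]; exact hm
    rw [Finset.sum_eq_single (Sym.mk (Finsupp.toMultiset m) hcard)]
    · simp
    · intro b _ hb
      rw [if_neg]
      rintro rfl
      apply hb
      ext1
      simp
    · simp
  · rw [Finset.sum_eq_zero, hp.coeff_eq_zero hm]
    intro b _
    rw [if_neg]
    rintro rfl
    apply hm
    exact (Multiset.toFinsupp_sum_eq _).trans b.2

lemma linSubst_symMonomial (g : Matrix (Fin n) (Fin n) ℂ) (a : Sym (Fin n) d) :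
    linSubst g (symMonomial a) = ∑ b, C (symSubstMat d g a b) * symMonomial b := by
  refine eq_sum_coeff_mul_symMonomial ?_
  have hX (i : Fin n) : (∑ j, C (g i j) * X j : MvPolynomial (Fin n) ℂ).IsHomogeneous 1 :=
    IsHomogeneous.sum _ _ _ fun j _ => isHomogeneous_C_mul_X _ _
  have ha : (symMonomial a).IsHomogeneous d :=
    isHomogeneous_monomial _ ((Multiset.toFinsupp_sum_eq _).trans a.2)
  have := ha.aeval _ hX
  rwa [one_mul] at this

lemma linDer_symMonomial (A : Matrix (Fin n) (Fin n) ℂ) (a : Sym (Fin n) d) :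
    linDer A (symMonomial a) = ∑ b, C (symMat n d A a b) * symMonomial b := by
  simp only [symMat, map_sum, Finset.sum_mul]
  rw [Finset.sum_comm, linDer, symMonomial, mkDerivation_monomial, one_smul,
    Finsupp.sum_fintype _ _ (by simp)]
  refine Finset.sum_congr rfl fun i _ => ?_
  rw [Finset.sum_comm, Finset.smul_sum]
  refine Finset.sum_congr rfl fun j _ => ?_
  simp only [Multiset.toFinsupp_apply]
  by_cases hi : i ∈ (a : Multiset (Fin n))
  · have hcard : Multiset.card ((a : Multiset (Fin n)).erase i + {j}) = d := by
      have := Multiset.card_pos_iff_exists_mem.mpr ⟨i, hi⟩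
      rw [Multiset.card_add, Multiset.card_erase_of_mem hi, Multiset.card_singleton]
      rw [Sym.card_coe] at this ⊢
      exact Nat.succ_pred_eq_of_pos this
    rw [Finset.sum_eq_single (Sym.mk _ hcard)]
    · have herase : Multiset.toFinsupp ((a : Multiset (Fin n)).erase i) =
          Multiset.toFinsupp (a : Multiset (Fin n)) - Finsupp.single i 1 := by
        rw [eq_tsub_iff_add_eq_of_le, ← Multiset.toFinsupp_singleton, ← Multiset.toFinsupp_add,
          add_comm, Multiset.singleton_add, Multiset.cons_erase hi]
        rw [Finsupp.single_le_iff, Multiset.toFinsupp_apply]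
        exact Multiset.one_le_count_iff_mem.mpr hi
      simp only [Sym.coe_mk, if_true, symMonomial, Multiset.toFinsupp_add, herase,
        Multiset.toFinsupp_singleton, X, C_mul_monomial, smul_eq_mul, monomial_mul, mul_one]
    · intro b _ hb
      rw [if_neg, map_zero, zero_mul]
      exact fun h => hb (Sym.ext h)
    · simp
  · simp [Multiset.count_eq_zero_of_notMem hi]

lemma symMonomial_ext {P Q : Matrix (Sym (Fin n) d) (Sym (Fin n) d) ℂ}
    (h : ∀ a, ∑ b, C (P a b) * symMonomial b = ∑ b, C (Q a b) * symMonomial b) : P = Q := by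
  ext a b
  have := congrArg (coeff (Multiset.toFinsupp (b : Multiset (Fin n)))) (h a)
  simpa [coeff_sum, coeff_C_mul, coeff_symMonomial] using this

lemma symSubstMat_mul (g h : Matrix (Fin n) (Fin n) ℂ) :
    symSubstMat d h * symSubstMat d g = symSubstMat d (h * g) := by
  refine symMonomial_ext fun a => ?_
  rw [← linSubst_symMonomial, ← linSubst_linSubst, linSubst_symMonomial]
  simp only [map_sum, map_mul, ← algebraMap_eq, AlgHom.commutes, linSubst_symMonomial,
    Matrix.mul_apply, Finset.mul_sum, Finset.sum_mul]
  rw [Finset.sum_comm]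
  simp [mul_assoc]

lemma symSubstMat_one : symSubstMat (n := n) d 1 = 1 := by
  have : linSubst (1 : Matrix (Fin n) (Fin n) ℂ) = AlgHom.id ℂ _ := by
    ext1 i
    simp [linSubst_X, Matrix.one_apply]
  ext a b
  simp [symSubstMat, this, coeff_symMonomial, Matrix.one_apply]

lemma symSubstMat_mul_symMat {g A B : Matrix (Fin n) (Fin n) ℂ} (h : g * A = B * g) :
    symSubstMat d g * symMat n d A = symMat n d B * symSubstMat d g := by
  refine symMonomial_ext fun a => ?_
  have := linDer_linSubst h (symMonomial a)
  rw [linSubst_symMonomial, linDer_symMonomial] at this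
  simp only [map_sum, Derivation.leibniz, map_mul, ← algebraMap_eq, AlgHom.commutes,
    Derivation.map_algebraMap, add_zero, smul_eq_mul, linSubst_symMonomial,
    linDer_symMonomial, mul_zero, Finset.mul_sum] at this
  simp only [Matrix.mul_apply, Finset.sum_mul, map_sum, map_mul, ← algebraMap_eq]
  rw [Finset.sum_comm]
  conv_rhs => rw [Finset.sum_comm]
  simpa [mul_assoc] using this

lemma charP_eq_of_semiconj {m : Type*} [Fintype m] [DecidableEq m] {P Q M N : Matrix m m ℂ}
    (hPQ : P * Q = 1) (h : P * M = N * P) : charP M = charP N := by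
  have hPQ' : P.map Polynomial.C * Q.map Polynomial.C = 1 := by
    rw [← Matrix.map_mul, hPQ, Matrix.map_one _ (by simp) (by simp)]
  have hdet : (P.map Polynomial.C).det * (Q.map Polynomial.C).det = 1 := by
    rw [← Matrix.det_mul, hPQ', Matrix.det_one]
  have h' : P.map Polynomial.C * M.map Polynomial.C = N.map Polynomial.C * P.map Polynomial.C := by
    rw [← Matrix.map_mul, h, Matrix.map_mul]
  have key := congrArg Matrix.det (show P.map Polynomial.C *
      ((Polynomial.X : Polynomial ℂ) • (1 : Matrix m m (Polynomial ℂ)) + M.map Polynomial.C) =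
      ((Polynomial.X : Polynomial ℂ) • (1 : Matrix m m (Polynomial ℂ)) + N.map Polynomial.C) *
        P.map Polynomial.C by
    rw [Matrix.mul_add, Matrix.add_mul, h']
    simp)
  rw [Matrix.det_mul, Matrix.det_mul, mul_comm] at key
  exact (IsUnit.of_mul_eq_one _ hdet).mul_right_cancel key

lemma charP_symMat_conj (g : GL (Fin n) ℂ) (A : Matrix (Fin n) (Fin n) ℂ) :
    charP (symMat n d ((g : Matrix (Fin n) (Fin n) ℂ) * A *
      ((g⁻¹ : GL (Fin n) ℂ) : Matrix (Fin n) (Fin n) ℂ))) = charP (symMat n d A) := by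
  have hg : ((g⁻¹ : GL (Fin n) ℂ) : Matrix (Fin n) (Fin n) ℂ) * g = 1 := g.inv_mul
  have hg' : (g : Matrix (Fin n) (Fin n) ℂ) *
      ((g⁻¹ : GL (Fin n) ℂ) : Matrix (Fin n) (Fin n) ℂ) = 1 := g.mul_inv
  refine (charP_eq_of_semiconj (P := symSubstMat d (g : Matrix (Fin n) (Fin n) ℂ))
    (Q := symSubstMat d ((g⁻¹ : GL (Fin n) ℂ) : Matrix (Fin n) (Fin n) ℂ)) ?_
    (symSubstMat_mul_symMat ?_)).symm
  · rw [symSubstMat_mul, hg', symSubstMat_one]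
  · rw [Matrix.mul_assoc _ _ (g : Matrix (Fin n) (Fin n) ℂ), hg, Matrix.mul_one]

end SymmetricPower

section Diagonalizable

variable {n : ℕ}

lemma exists_conj_diagonal_of_isCoprime (A : Matrix (Fin n) (Fin n) ℂ)
    (hA : IsCoprime A.charpoly (Polynomial.derivative A.charpoly)) :
    ∃ (g : GL (Fin n) ℂ) (y : Fin n → ℂ), A = (g : Matrix (Fin n) (Fin n) ℂ) *
      Matrix.diagonal y * ((g⁻¹ : GL (Fin n) ℂ) : Matrix (Fin n) (Fin n) ℂ) := by
  have hcard : Fintype.card (Fin n) = Fintype.card A.charpoly.roots.toFinset := by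
    have hnodup : A.charpoly.roots.Nodup := Polynomial.nodup_roots hA
    rw [Fintype.card_coe, Multiset.toFinset_card_of_nodup hnodup,
      ← (IsAlgClosed.splits A.charpoly).natDegree_eq_card_roots, Matrix.charpoly_natDegree_eq_dim]
  let e := Fintype.equivOfCardEq hcard
  have hev (i : Fin n) : Module.End.HasEigenvalue (Matrix.toLin' A) (e i : ℂ) := by
    rw [Module.End.hasEigenvalue_iff_isRoot_charpoly, Matrix.charpoly_toLin']
    exact Polynomial.isRoot_of_mem_roots (Multiset.mem_toFinset.mp (e i).2)
  choose v hv using fun i => (hev i).exists_hasEigenvector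
  have hli : LinearIndependent ℂ v := Module.End.eigenvectors_linearIndependent' _
    (fun i => (e i : ℂ)) (Subtype.val_injective.comp e.injective) v hv
  let P : Matrix (Fin n) (Fin n) ℂ := (Matrix.of v)ᵀ
  have hP : IsUnit P := by
    rw [Matrix.isUnit_transpose, ← Matrix.linearIndependent_rows_iff_isUnit]
    exact hli
  have hAP : A * P = P * Matrix.diagonal (fun i => (e i : ℂ)) := by
    ext i j
    have := congrFun (hv j).apply_eq_smul i
    rw [Matrix.mul_diagonal]
    simpa [Matrix.mulVec, dotProduct, Matrix.mul_apply, P, mul_comm] using this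
  refine ⟨hP.unit, fun i => (e i : ℂ), ?_⟩
  rw [IsUnit.unit_spec, ← hAP, Matrix.mul_assoc]
  have : P * ((hP.unit⁻¹ : GL (Fin n) ℂ) : Matrix (Fin n) (Fin n) ℂ) = 1 := hP.unit.mul_inv
  rw [this, Matrix.mul_one]

/-- Evaluation of a polynomial function at a matrix. -/
def evalMat (A : Matrix (Fin n) (Fin n) ℂ) : MvPolynomial (Fin n × Fin n) ℂ →ₐ[ℂ] ℂ :=
  aeval fun p => A p.1 p.2

lemma glGen_map_evalMat (A : Matrix (Fin n) (Fin n) ℂ) : (glGen n).map (evalMat A) = A := by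
  ext i j
  simp [glGen, evalMat]

lemma evalMat_glConj (g : GL (Fin n) ℂ) (A : Matrix (Fin n) (Fin n) ℂ)
    (f : MvPolynomial (Fin n × Fin n) ℂ) :
    evalMat A (glConj g f) = evalMat ((g : Matrix (Fin n) (Fin n) ℂ) * A *
      ((g⁻¹ : GL (Fin n) ℂ) : Matrix (Fin n) (Fin n) ℂ)) f := by
  have : (evalMat A).comp (glConj g) = evalMat ((g : Matrix (Fin n) (Fin n) ℂ) * A *
      ((g⁻¹ : GL (Fin n) ℂ) : Matrix (Fin n) (Fin n) ℂ)) := by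
    ext1 p
    simp [glConj, evalMat, Matrix.mul_apply, glGen]
  exact DFunLike.congr_fun this f

lemma eq_of_evalMat_eq {f h : MvPolynomial (Fin n × Fin n) ℂ}
    (H : ∀ A : Matrix (Fin n) (Fin n) ℂ, evalMat A f = evalMat A h) : f = h := by
  refine MvPolynomial.funext fun x => ?_
  rw [← coe_aeval_eq_eval]
  exact H (Matrix.of fun i j => x (i, j))

lemma mem_glInvariants_iff {f : MvPolynomial (Fin n × Fin n) ℂ} :
    f ∈ glInvariants n ↔ ∀ (g : GL (Fin n) ℂ) (A : Matrix (Fin n) (Fin n) ℂ),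
      evalMat ((g : Matrix (Fin n) (Fin n) ℂ) * A *
        ((g⁻¹ : GL (Fin n) ℂ) : Matrix (Fin n) (Fin n) ℂ)) f = evalMat A f := by
  constructor
  · intro hf g A
    rw [← evalMat_glConj, hf g]
  · intro hf g
    exact eq_of_evalMat_eq fun A => by rw [evalMat_glConj, hf]

/-- Restriction of polynomial functions to diagonal matrices. -/
def diagRes (n : ℕ) : MvPolynomial (Fin n × Fin n) ℂ →ₐ[ℂ] MvPolynomial (Fin n) ℂ :=
  aeval fun p => Matrix.diagonal X p.1 p.2

lemma glGen_map_diagRes : (glGen n).map (diagRes n) = Matrix.diagonal X := by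
  ext i j : 2
  simp [glGen, diagRes]

lemma aeval_diagRes (y : Fin n → ℂ) (f : MvPolynomial (Fin n × Fin n) ℂ) :
    aeval y (diagRes n f) = evalMat (Matrix.diagonal y) f := by
  have : (aeval y).comp (diagRes n) = evalMat (Matrix.diagonal y) := by
    ext1 p
    by_cases h : p.1 = p.2 <;> simp [diagRes, evalMat, Matrix.diagonal_apply, h]
  exact DFunLike.congr_fun this f

lemma eq_zero_of_diagRes_eq_zero {f : MvPolynomial (Fin n × Fin n) ℂ} (hf : f ∈ glInvariants n)
    (h0 : diagRes n f = 0) : f = 0 := by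
  let χ := (glGen n).charpoly
  let r := Polynomial.resultant χ (Polynomial.derivative χ) n (n - 1)
  have hr (A : Matrix (Fin n) (Fin n) ℂ) :
      evalMat A r ≠ 0 ↔ IsCoprime A.charpoly (Polynomial.derivative A.charpoly) := by
    have hχ : χ.map (evalMat A : _ →+* ℂ) = A.charpoly := by
      rw [← Matrix.charpoly_map]
      exact congrArg _ (glGen_map_evalMat A)
    have hdeg : A.charpoly.natDegree = n := by simp [Matrix.charpoly_natDegree_eq_dim]
    have h1 : evalMat A r = Polynomial.resultant A.charpoly (Polynomial.derivative A.charpoly) := by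
      have := Polynomial.resultant_map_map χ (Polynomial.derivative χ) n (n - 1)
        (evalMat A : _ →+* ℂ)
      rw [← Polynomial.derivative_map, hχ] at this
      rw [Polynomial.natDegree_derivative, hdeg]
      exact this.symm
    rw [h1, Ne, Polynomial.resultant_eq_zero_iff]
    simp [(Matrix.charpoly_monic A).ne_zero]
  have hr0 : r ≠ 0 := by
    intro h
    refine (hr (Matrix.diagonal fun i => ((i : ℕ) : ℂ))).mpr ?_ (by rw [h, map_zero])
    rw [Matrix.charpoly_diagonal]
    refine Polynomial.separable_prod_X_sub_C_iff.mpr fun i j hij => ?_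
    exact Fin.ext (by exact_mod_cast hij)
  have hmul : f * r = 0 := by
    refine eq_of_evalMat_eq fun A => ?_
    rw [map_mul, map_zero]
    by_cases hA : evalMat A r = 0
    · rw [hA, mul_zero]
    obtain ⟨g, y, rfl⟩ := exists_conj_diagonal_of_isCoprime A ((hr A).mp hA)
    rw [mem_glInvariants_iff.mp hf, ← aeval_diagRes, h0, map_zero, zero_mul]
  exact (mul_eq_zero.mp hmul).resolve_right hr0

lemma diagRes_isSymmetric {f : MvPolynomial (Fin n × Fin n) ℂ} (hf : f ∈ glInvariants n) :
    (diagRes n f).IsSymmetric := by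
  intro σ
  refine MvPolynomial.funext fun y => ?_
  have key : aeval y (rename σ (diagRes n f)) = aeval y (diagRes n f) := by
    rw [aeval_rename, aeval_diagRes, aeval_diagRes]
    have hPQ : σ.permMatrix ℂ * (σ⁻¹).permMatrix ℂ = 1 := by
      rw [← Matrix.permMatrix_mul]
      simp
    let g : GL (Fin n) ℂ := ⟨σ.permMatrix ℂ, (σ⁻¹).permMatrix ℂ, hPQ, mul_eq_one_comm.mp hPQ⟩
    rw [← mem_glInvariants_iff.mp hf g (Matrix.diagonal y)]
    have hconj : σ.permMatrix ℂ * Matrix.diagonal y * (σ⁻¹).permMatrix ℂ =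
        Matrix.diagonal (y ∘ σ) := by
      rw [Equiv.Perm.permMatrix, Equiv.Perm.permMatrix, PEquiv.toMatrix_toPEquiv_mul,
        PEquiv.mul_toMatrix_toPEquiv, Matrix.submatrix_submatrix]
      exact Matrix.submatrix_diagonal_equiv y σ
    exact congrArg (evalMat · f) hconj.symm
  rw [← coe_aeval_eq_eval]
  exact key

end Diagonalizable

section Invariants

variable {n d : ℕ}

lemma symMat_map {R R' : Type*} [CommRing R] [CommRing R'] (φ : R →+* R')
    (A : Matrix (Fin n) (Fin n) R) : (symMat n d A).map φ = symMat n d (A.map φ) := by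
  ext a b
  simp only [symMat, Matrix.map_apply, map_sum]
  refine Finset.sum_congr rfl fun i _ => Finset.sum_congr rfl fun j _ => ?_
  split_ifs <;> simp

lemma coeff_charP_map {m R R' : Type*} [Fintype m] [DecidableEq m] [CommRing R] [CommRing R']
    (φ : R →+* R') (M : Matrix m m R) (k : ℕ) :
    (charP (M.map φ)).coeff k = φ ((charP M).coeff k) := by
  rw [← Polynomial.coeff_map, _root_.charP, _root_.charP, ← Polynomial.coe_mapRingHom,
    RingHom.map_det]
  congr 2
  ext1 i j
  by_cases h : i = j <;> simp [h]

lemma charP_diagonal {m R : Type*} [Fintype m] [DecidableEq m] [CommRing R] (w : m → R) :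
    charP (Matrix.diagonal w) = ∏ a, (Polynomial.X + Polynomial.C (w a)) := by
  rw [_root_.charP, ← Matrix.det_diagonal]
  congr 1
  ext1 i j
  by_cases h : i = j <;> simp [h]

lemma symMat_diagonal {R : Type*} [CommRing R] (y : Fin n → R) :
    symMat n d (Matrix.diagonal y) =
      Matrix.diagonal fun a : Sym (Fin n) d => ((a : Multiset (Fin n)).map y).sum := by
  ext a b
  have hterm (i : Fin n) : (∑ j : Fin n,
      if (b : Multiset (Fin n)) = ((a : Multiset (Fin n)).erase i) + {j}
      then (Multiset.count i (a : Multiset (Fin n)) : R) * Matrix.diagonal y i j else 0) =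
      if a = b then (Multiset.count i (a : Multiset (Fin n)) : R) * y i else 0 := by
    rw [Finset.sum_eq_single i (fun j _ hj => by simp [Matrix.diagonal_apply_ne' _ hj]) (by simp),
      Matrix.diagonal_apply_eq]
    by_cases hi : i ∈ (a : Multiset (Fin n))
    · rw [add_comm, Multiset.singleton_add, Multiset.cons_erase hi]
      simp only [Sym.coe_inj, eq_comm]
    · simp [Multiset.count_eq_zero_of_notMem hi]
  rw [symMat, Finset.sum_congr rfl fun i _ => hterm i, Matrix.diagonal_apply]
  split_ifs
  · rw [Finset.sum_multiset_map_count]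
    simp only [nsmul_eq_mul]
    refine (Finset.sum_subset (Finset.subset_univ _) fun i _ hi => ?_).symm
    rw [Multiset.mem_toFinset] at hi
    simp [Multiset.count_eq_zero_of_notMem hi]
  · simp

lemma eq_glInvariants_of_le_map_diagRes {S : Subalgebra ℂ (MvPolynomial (Fin n × Fin n) ℂ)}
    (hS : S ≤ glInvariants n) (h : symmetricSubalgebra (Fin n) ℂ ≤ S.map (diagRes n)) :
    S = glInvariants n := by
  refine le_antisymm hS fun f hf => ?_
  obtain ⟨f', hf', heq⟩ := h (diagRes_isSymmetric hf)
  have : f - f' = 0 := eq_zero_of_diagRes_eq_zero ((glInvariants n).sub_mem hf (hS hf')) <| by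
    rw [map_sub, sub_eq_zero]
    exact heq.symm
  rwa [sub_eq_zero.mp this]

lemma coeffAlg_le_glInvariants : coeffAlg ℂ (symMat n d (glGen n)) ≤ glInvariants n := by
  refine Algebra.adjoin_le ?_
  rintro _ ⟨k, rfl⟩
  have heval (A : Matrix (Fin n) (Fin n) ℂ) :
      evalMat A ((charP (symMat n d (glGen n))).coeff k) = (charP (symMat n d A)).coeff k := by
    have h := coeff_charP_map (evalMat A : _ →+* ℂ) (symMat n d (glGen n)) k
    rw [symMat_map] at h
    exact h.symm.trans (congrArg (fun B => (charP (symMat n d B)).coeff k) (glGen_map_evalMat A))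
  refine mem_glInvariants_iff.mpr fun g A => ?_
  rw [heval, heval, charP_symMat_conj]

lemma symmetricSubalgebra_le_map_coeffAlg (hd : 0 < d) :
    symmetricSubalgebra (Fin n) ℂ ≤ (coeffAlg ℂ (symMat n d (glGen n))).map (diagRes n) := by
  refine symmetricSubalgebra_le_of_psum_mem _ fun k _ _ => ?_
  refine sum_pow_mem_of_symPowerSum_mem _ X hd (fun j => ?_) k
  refine sum_pow_mem_of_coeff_mem _ _ (fun j => ?_) j
  rw [← charP_diagonal, ← symMat_diagonal]
  refine ⟨(charP (symMat n d (glGen n))).coeff j, Algebra.subset_adjoin ⟨j, rfl⟩, ?_⟩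
  have h := coeff_charP_map (diagRes n : _ →+* MvPolynomial (Fin n) ℂ) (symMat n d (glGen n)) j
  rw [symMat_map] at h
  exact h.symm.trans
    (congrArg (fun B => (charP (symMat n d B)).coeff j) glGen_map_diagRes)

lemma map_trace_glGen_pow {R : Type*} [CommRing R] [Algebra ℂ R]
    (φ : MvPolynomial (Fin n × Fin n) ℂ →ₐ[ℂ] R) (k : ℕ) :
    φ (Matrix.trace (glGen n ^ k)) = Matrix.trace ((glGen n).map φ ^ k) := by
  rw [AddMonoidHom.map_trace φ, ← AlgHom.mapMatrix_apply, ← AlgHom.mapMatrix_apply, map_pow]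

lemma trace_glGen_pow_mem (k : ℕ) : Matrix.trace (glGen n ^ k) ∈ glInvariants n := by
  refine mem_glInvariants_iff.mpr fun g A => ?_
  rw [map_trace_glGen_pow, map_trace_glGen_pow, glGen_map_evalMat, glGen_map_evalMat,
    Units.conj_pow, Matrix.trace_mul_comm, ← Matrix.mul_assoc, Units.inv_mul, Matrix.one_mul]

lemma diagRes_trace_glGen_pow (k : ℕ) :
    diagRes n (Matrix.trace (glGen n ^ k)) = psum (Fin n) ℂ k := by
  rw [map_trace_glGen_pow, glGen_map_diagRes, Matrix.diagonal_pow, Matrix.trace_diagonal]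
  rfl

lemma adjoin_trace_glGen_pow :
    Algebra.adjoin ℂ (Set.range fun i : Fin n => Matrix.trace (glGen n ^ ((i : ℕ) + 1))) =
      glInvariants n := by
  refine eq_glInvariants_of_le_map_diagRes (Algebra.adjoin_le ?_) ?_
  · rintro _ ⟨i, rfl⟩
    exact trace_glGen_pow_mem _
  · rw [AlgHom.map_adjoin, ← Set.range_comp, ← adjoin_psum_eq_symmetricSubalgebra]
    simp only [Function.comp_def, diagRes_trace_glGen_pow, le_refl]

lemma algebraicIndependent_trace_glGen_pow :
    AlgebraicIndependent ℂ fun i : Fin n => Matrix.trace (glGen n ^ ((i : ℕ) + 1)) := by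
  refine AlgebraicIndependent.of_comp (diagRes n) ?_
  simpa only [Function.comp_def, diagRes_trace_glGen_pow] using algebraicIndependent_psum n

end Invariants

/-- the coefficient algebra of `gl_n(ℂ)` on `S^d(ℂ^n)` equals the invariant
ring of the conjugation action of `GL_n(ℂ)`, and the latter is the polynomial subalgebra
generated by the trace functions `Tr_i = Tr(X^i)`, `1 ≤ i ≤ n`. -/
theorem coeffAlg_gl_symPow (n d : ℕ) (hn : 2 ≤ n) (hd : 1 ≤ d) :
    coeffAlg ℂ (symMat n d (glGen n)) = glInvariants n ∧
    glInvariants n =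
      Algebra.adjoin ℂ (Set.range fun i : Fin n => Matrix.trace (glGen n ^ ((i : ℕ) + 1))) ∧
    AlgebraicIndependent ℂ (fun i : Fin n => Matrix.trace (glGen n ^ ((i : ℕ) + 1))) := by
  exact ⟨eq_glInvariants_of_le_map_diagRes coeffAlg_le_glInvariants
    (symmetricSubalgebra_le_map_coeffAlg hd), adjoin_trace_glGen_pow.symm,
    algebraicIndependent_trace_glGen_pow⟩
end
end

section
/- Let n ≥ 2 and d ≥ 1. With respect to the standard basis {E_{ij} : 1 ≤ i ≤ j ≤ n} of ut_n(C) (with variable x_{ij} attached to E_{ij}, and write x_i := x_{ii}), the characteristic polynomial of ut_n(C) on S^d(C^n) is φ_{ut_n(C)}(S^d(C^n)) = Π_{(d_1,…,d_n) ∈ N^n, d_1+⋯+d_n=d} (x_0 + Σ_{i=1}^n d_i·x_i); in particular it does not involve the variables x_{ij} with i < j. -/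
open MvPolynomial Matrix

noncomputable section

/-- If the nonzero off-diagonal entries of a square matrix strictly increase some weight of the
indices, then the determinant is the product of the diagonal entries. -/
theorem Matrix.det_eq_prod_diag_of_weight {m R : Type*} [Fintype m] [DecidableEq m] [CommRing R]
    (M : Matrix m m R) (w : m → ℕ) (h : ∀ a b, M a b ≠ 0 → a = b ∨ w a < w b) :
    M.det = ∏ a, M a a := by
  have htri : M.BlockTriangular w := by
    intro a b hab
    by_contra hne
    rcases h a b hne with rfl | hlt
    · exact lt_irrefl _ hab
    · exact lt_asymm hab hlt
  have hblock (k : ℕ) : (M.toSquareBlock w k).det = ∏ a : {a // w a = k}, M a a := by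
    have hdiag : M.toSquareBlock w k = Matrix.diagonal fun a : {a // w a = k} => M a a := by
      ext a b
      rcases eq_or_ne a b with rfl | hab
      · simp [Matrix.toSquareBlock_def]
      · rw [Matrix.diagonal_apply_ne _ hab]
        by_contra hne
        rcases h a b hne with heq | hlt
        · exact hab (Subtype.ext heq)
        · exact absurd hlt (by rw [a.2, b.2]; exact lt_irrefl k)
    rw [hdiag, Matrix.det_diagonal]
  rw [htri.det, ← Finset.prod_fiberwise_of_maps_to
    (fun a _ => Finset.mem_image_of_mem w (Finset.mem_univ a))]
  refine Finset.prod_congr rfl fun k _ => ?_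
  rw [hblock]
  exact (Finset.prod_subtype _ (by simp) fun a => M a a).symm

/-- The diagonal entries of the action on the symmetric power are the weights
`∑ i, dᵢ * A i i`. -/
theorem symMat_diag {R : Type*} [CommRing R] (n d : ℕ) (A : Matrix (Fin n) (Fin n) R)
    (a : Sym (Fin n) d) :
    symMat n d A a a =
      ∑ i, (Multiset.count i (a : Multiset (Fin n)) : R) * A i i := by
  refine Finset.sum_congr rfl fun i _ => ?_
  by_cases hi : i ∈ (a : Multiset (Fin n))
  · have hiff (j : Fin n) :
        (a : Multiset (Fin n)) = (a : Multiset (Fin n)).erase i + {j} ↔ j = i := by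
      rw [add_comm, Multiset.singleton_add]
      conv_lhs => lhs; rw [← Multiset.cons_erase hi]
      rw [Multiset.cons_inj_left, eq_comm]
    simp [hiff]
  · simp [Multiset.count_eq_zero_of_notMem hi]

/-- For an upper triangular matrix, the nonzero off-diagonal entries of the action on the symmetric
power strictly increase the sum of the indices of a monomial. -/
theorem eq_or_sum_lt_of_symMat_ne_zero {R : Type*} [CommRing R] {n d : ℕ}
    {A : Matrix (Fin n) (Fin n) R} (hA : A.BlockTriangular id) {a b : Sym (Fin n) d}
    (h : symMat n d A a b ≠ 0) :
    a = b ∨ ((a : Multiset (Fin n)).map Fin.val).sum < ((b : Multiset (Fin n)).map Fin.val).sum := by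
  obtain ⟨i, -, hi⟩ := Finset.exists_ne_zero_of_sum_ne_zero h
  obtain ⟨j, -, hij⟩ := Finset.exists_ne_zero_of_sum_ne_zero hi
  obtain ⟨hb, hne⟩ := ite_ne_right_iff.mp hij
  have hmem : i ∈ (a : Multiset (Fin n)) := by
    by_contra hnot
    simp [Multiset.count_eq_zero_of_notMem hnot] at hne
  have hle : i ≤ j := by
    by_contra! hlt
    exact hne (by rw [hA hlt, mul_zero])
  have ha := Multiset.cons_erase hmem
  rw [add_comm, Multiset.singleton_add] at hb
  rcases hle.eq_or_lt with rfl | hlt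
  · exact Or.inl (Sym.coe_injective (ha.symm.trans hb.symm))
  · right
    rw [hb, ← ha]
    simpa using hlt

theorem utGen_blockTriangular (n : ℕ) : (utGen n).BlockTriangular id :=
  fun _ _ hij => dif_neg (not_le_of_gt hij)

/-- The characteristic polynomial of an upper triangular matrix on a symmetric power is the product
over all monomials of the linear forms given by their weights. -/
theorem charP_symMat_of_blockTriangular {R : Type*} [CommRing R] (n d : ℕ)
    {A : Matrix (Fin n) (Fin n) R} (hA : A.BlockTriangular id) :
    charP (symMat n d A) = ∏ a : Sym (Fin n) d,
      (Polynomial.X + Polynomial.C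
        (∑ i, (Multiset.count i (a : Multiset (Fin n)) : R) * A i i)) := by
  rw [_root_.charP, Matrix.det_eq_prod_diag_of_weight _
    (fun a : Sym (Fin n) d => ((a : Multiset (Fin n)).map Fin.val).sum)]
  · refine Finset.prod_congr rfl fun a _ => ?_
    simp [symMat_diag]
  · intro a b hab
    rcases eq_or_ne a b with heq | hne
    · exact Or.inl heq
    · refine eq_or_sum_lt_of_symMat_ne_zero hA fun h0 => hab ?_
      simp [hne, h0]

/-- the characteristic polynomial of `ut_n(ℂ)` on `S^d(ℂ^n)` is the product
of the linear forms `x₀ + Σᵢ dᵢ·xᵢ` over all tuples `(d₁,…,d_n)` of nonnegative integers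
summing to `d`; in particular it involves only the diagonal variables. -/
theorem charP_ut_symPow (n d : ℕ) (hn : 2 ≤ n) (hd : 1 ≤ d) :
    charP (symMat n d (utGen n)) =
      ∏ v ∈ Finset.Nat.antidiagonalTuple n d,
        (Polynomial.X + Polynomial.C (∑ i : Fin n,
          (v i : MvPolynomial (UTIdx n) ℂ) * MvPolynomial.X ⟨(i, i), le_rfl⟩)) := by
  let := Fintype.ofEquiv _ (Sym.equivNatSumOfFintype (Fin n) d)
  rw [charP_symMat_of_blockTriangular n d (utGen_blockTriangular n),
    Finset.prod_subtype (p := fun v : Fin n → ℕ => ∑ i, v i = d) _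
      (fun v => Finset.Nat.mem_antidiagonalTuple)]
  refine Fintype.prod_equiv (Sym.equivNatSumOfFintype (Fin n) d) _ _ fun a => ?_
  simp [utGen]
end
end
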